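/- Let s ∈ ℕ with s ≥ 2 and p ∈ (0,1). Let N_c be a random variable following the binomial distribution B(s(s−1), p), and define the estimator p̂ = N_c/(s(s−1)). Then the mean absolute error of p̂ satisfies E[|p̂ − p|] = 2 · Σ_{k=0}^{⌈s(s−1)p⌉−1} C(s(s−1), k) · p^k · (1−p)^{s(s−1)−k} · (p − k/(s(s−1))), where C(n,k) denotes the binomial coefficient and ⌈·⌉ is the ceiling function. -/

import Mathlib

open MeasureTheory ProbabilityTheory Finset

theorem binom_sum_aux (n : ℕ) (hn : 0 < n) (p : ℝ) (hp : p ∈ Set.Ioo (0 : ℝ) 1) :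
    ∑ k ∈ Finset.range (n + 1),
      ((n.choose k : ℝ) * p ^ k * (1 - p) ^ (n - k)) * |(k : ℝ) / n - p| =
    2 * ∑ k ∈ Finset.range ⌈(n : ℝ) * p⌉₊,
      (n.choose k : ℝ) * p ^ k * (1 - p) ^ (n - k) * (p - (k : ℝ) / n) := by
  have hn' : (0 : ℝ) < n := by exact_mod_cast hn
  have h1 := congrArg (Polynomial.eval p) (bernsteinPolynomial.sum ℝ n)
  have h2 := congrArg (Polynomial.eval p) (bernsteinPolynomial.sum_smul ℝ n)
  simp only [bernsteinPolynomial, Polynomial.eval_finsetSum, Polynomial.eval_mul,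
    Polynomial.eval_pow, Polynomial.eval_sub, Polynomial.eval_one, Polynomial.eval_X,
    Polynomial.eval_natCast, nsmul_eq_mul] at h1 h2
  set w : ℕ → ℝ := fun k => (n.choose k : ℝ) * p ^ k * (1 - p) ^ (n - k) with hw
  change ∑ k ∈ Finset.range (n + 1), w k = 1 at h1
  change ∑ k ∈ Finset.range (n + 1), (k : ℝ) * w k = n * p at h2
  change ∑ k ∈ Finset.range (n + 1), w k * |(k : ℝ) / n - p| =
    2 * ∑ k ∈ Finset.range ⌈(n : ℝ) * p⌉₊, w k * (p - (k : ℝ) / n)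
  have h3 : ∑ k ∈ Finset.range (n + 1), w k * ((k : ℝ) / n - p) = 0 := by
    have : ∀ k ∈ Finset.range (n + 1),
        w k * ((k : ℝ) / n - p) = (k * w k) / n - w k * p := fun k _ => by ring
    rw [Finset.sum_congr rfl this, Finset.sum_sub_distrib, ← Finset.sum_div, ← Finset.sum_mul,
      h1, h2]
    field_simp
    ring
  have hc : ⌈(n : ℝ) * p⌉₊ ≤ n + 1 := by
    apply Nat.ceil_le.2
    push_cast
    nlinarith [hp.2]
  have h4 : ∑ k ∈ Finset.range ⌈(n : ℝ) * p⌉₊, w k * (p - (k : ℝ) / n) =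
      ∑ k ∈ Finset.range (n + 1), w k * max (p - (k : ℝ) / n) 0 := by
    rw [← Finset.sum_subset (Finset.range_subset_range.2 hc)]
    · refine Finset.sum_congr rfl fun k hk => ?_
      have := Nat.lt_ceil.1 (Finset.mem_range.1 hk)
      have : (k : ℝ) / n < p := by rw [div_lt_iff₀ hn']; linarith
      rw [max_eq_left (by linarith)]
    · intro k _ hk
      have := Nat.ceil_le.1 (not_lt.1 (fun h => hk (Finset.mem_range.2 h)))
      have : p ≤ (k : ℝ) / n := by rw [le_div_iff₀ hn']; linarith
      rw [max_eq_right (by linarith), mul_zero]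
  rw [h4, Finset.mul_sum]
  refine Eq.trans ?_ (add_zero _)
  refine Eq.trans ?_ (congrArg _ h3)
  rw [← Finset.sum_add_distrib]
  refine Finset.sum_congr rfl fun k _ => ?_
  rcases le_total (p - (k : ℝ) / n) 0 with h | h
  · rw [max_eq_right h, abs_of_nonneg (by linarith)]; ring
  · rw [max_eq_left h, abs_of_nonpos (by linarith)]; ring

theorem integral_aux {Ω : Type*} [MeasurableSpace Ω] (μ : Measure Ω) [IsProbabilityMeasure μ]
    (N : Ω → ℕ) (hN : Measurable N) (n : ℕ) (w : ℕ → ℝ) (hw : ∀ k, 0 ≤ w k)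
    (hw0 : ∀ k, n < k → w k = 0) (hlaw : ∀ k, μ {ω | N ω = k} = ENNReal.ofReal (w k))
    (f : ℕ → ℝ) :
    ∫ ω, f (N ω) ∂μ = ∑ k ∈ Finset.range (n + 1), w k * f k := by
  have hm : ∀ k, MeasurableSet {ω | N ω = k} := fun k => hN (measurableSet_singleton k)
  have hae : ∀ᵐ ω ∂μ, ∀ k, n < k → N ω ≠ k := by
    rw [ae_all_iff]
    intro k
    by_cases hk : n < k
    · have : μ {ω | N ω = k} = 0 := by rw [hlaw, hw0 k hk]; simp
      rw [ae_iff]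
      simpa [hk] using this
    · simp [hk]
  have : (fun ω => f (N ω)) =ᵐ[μ] fun ω => ∑ k ∈ Finset.range (n + 1),
      Set.indicator {ω | N ω = k} (fun _ => f k) ω := by
    filter_upwards [hae] with ω h
    have hle : N ω < n + 1 := by
      by_contra hc
      exact h (N ω) (by omega) rfl
    simp [Set.indicator_apply, hle]
    try omega
  rw [integral_congr_ae this, integral_finsetSum]
  · refine Finset.sum_congr rfl fun k _ => ?_
    rw [integral_indicator_const _ (hm k), Measure.real, hlaw, ENNReal.toReal_ofReal (hw k),
      smul_eq_mul]
  · intro k _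
    exact (integrable_const _).indicator (hm k)

/-- Let `s ≥ 2` and `p ∈ (0,1)`. If `N_c` follows the binomial distribution
`B(s(s-1), p)` and `p̂ = N_c / (s(s-1))`, then the mean absolute error of `p̂` is
`E[|p̂ - p|] = 2 ∑_{k=0}^{⌈s(s-1)p⌉-1} C(s(s-1),k) p^k (1-p)^{s(s-1)-k} (p - k/(s(s-1)))`. -/
theorem mean_absolute_error_of_binomial_estimator
    (s : ℕ) (hs : 2 ≤ s) (p : ℝ) (hp : p ∈ Set.Ioo (0 : ℝ) 1)
    {Ω : Type*} [MeasureSpace Ω] [IsProbabilityMeasure (ℙ : Measure Ω)]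
    (Nc : Ω → ℕ) (hNc : Measurable Nc)
    (hlaw : ∀ k : ℕ,
       (ℙ : Measure Ω) {ω | Nc ω = k} =
        ENNReal.ofReal
          ((Nat.choose (s * (s - 1)) k : ℝ) * p ^ k * (1 - p) ^ (s * (s - 1) - k))) :
    ∫ ω, |(Nc ω : ℝ) / (s * (s - 1)) - p| ∂(ℙ : Measure Ω) =
      2 * ∑ k ∈ Finset.range ⌈(s * (s - 1) : ℝ) * p⌉₊,
        (Nat.choose (s * (s - 1)) k : ℝ) * p ^ k * (1 - p) ^ (s * (s - 1) - k) *
          (p - (k : ℝ) / (s * (s - 1))) := by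
  have hcast : ((s * (s - 1) : ℕ) : ℝ) = (s : ℝ) * (s - 1) := by
    rw [Nat.cast_mul, Nat.cast_sub (by omega)]; simp
  have hpos : 0 < s * (s - 1) := Nat.mul_pos (by omega) (by omega)
  rw [← hcast]
  rw [← binom_sum_aux _ hpos p hp]
  refine integral_aux _ Nc hNc (s * (s - 1))
    (fun k => (Nat.choose (s * (s - 1)) k : ℝ) * p ^ k * (1 - p) ^ (s * (s - 1) - k)) ?_ ?_ hlaw
    (fun k => |(k : ℝ) / ((s * (s - 1) : ℕ) : ℝ) - p|)
  · intro k
    have h0 := hp.1.le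
    have h1 : 0 ≤ 1 - p := by linarith [hp.2]
    positivity
  · intro k hk
    simp [Nat.choose_eq_zero_of_lt hk]
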